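/- Let σ > 0 and let f belong sectionally to (ℰ_σ^∞)_+(ℝ²) with M = sup_{(x,y)∈ℝ²}|f(x,y)|. Then for all x₁, y₁, y₂ ∈ ℝ with y₁ ≠ y₂ and σy₁ ∉ 2πℤ, the series ∑_{n∈ℤ} [σ(f(x₁,y₁) − f(x₁, 2πn/σ))/(σy₁ − 2πn)] · [(e^{iσy₂} − 1)/(i(σy₂ − 2πn))] converges absolutely and equals the divided difference (f(x₁,y₁) − f(x₁,y₂))/(y₁ − y₂) (the second factor being understood via its entire extension, with value 1, when σy₂ = 2πn). Moreover, ∑_{n∈ℤ} σ²|f(x₁,y₁) − f(x₁, 2πn/σ)|²/(σy₁ − 2πn)² ≤ (4/π)σ²M² and ∑_{n∈ℤ} |e^{iσy₂} − 1|²/(σy₂ − 2πn)² = 1; in particular the divided difference in the second variable admits a Haagerup-type factorization with constant (2/√π)σM. -/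

import Mathlib

open MeasureTheory

/-- The class `(ℰ_σ^∞)₊`: entire functions that are bounded on the closed upper half-plane
and such that `e^{-iσz} f(z)` is bounded on the closed lower half-plane (equivalently,
bounded functions on `ℝ` whose Fourier transform is supported in `[0, σ]`). -/
def MemEInftyPlus (σ : ℝ) (f : ℂ → ℂ) : Prop :=
  Differentiable ℂ f ∧
  (∃ C : ℝ, ∀ z : ℂ, 0 ≤ z.im → ‖f z‖ ≤ C) ∧
  (∃ C : ℝ, ∀ z : ℂ, z.im ≤ 0 → ‖Complex.exp (-(Complex.I * (σ : ℂ) * z)) * f z‖ ≤ C)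

/-- The factor `(e^{iσy} − 1)/(i(σy − 2πn))`, understood as the value `1` of its entire
extension when `σy = 2πn`. -/
noncomputable def sincFac (σ : ℝ) (n : ℤ) (y : ℝ) : ℂ :=
  if σ * y = 2 * Real.pi * n then 1
  else (Complex.exp (Complex.I * ((σ * y : ℝ) : ℂ)) - 1) /
    (Complex.I * (((σ * y : ℝ) : ℂ) - ((2 * Real.pi * n : ℝ) : ℂ)))

/-- `f : ℂ × ℂ → ℂ` belongs sectionally to `(ℰ_σ^∞)₊(ℝ²)`: for every `a ∈ ℝ` the
functions `z ↦ f(z, a)` and `z ↦ f(a, z)` belong to `(ℰ_σ^∞)₊`. -/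
def SectEInftyPlus (σ : ℝ) (f : ℂ → ℂ → ℂ) : Prop :=
  ∀ a : ℝ, MemEInftyPlus σ (fun z => f z (a : ℂ)) ∧ MemEInftyPlus σ (fun z => f (a : ℂ) z)

open Filter Topology Set

/-- The quotient of two entire functions is entire when the denominator has only simple zeros and
the numerator vanishes there. -/
theorem exists_differentiable_quotient {D E : ℂ → ℂ} (hD : Differentiable ℂ D)
    (hE : Differentiable ℂ E) (hsimple : ∀ z, E z = 0 → deriv E z ≠ 0)
    (hzero : ∀ z, E z = 0 → D z = 0) :
    ∃ Q : ℂ → ℂ, Differentiable ℂ Q ∧ ∀ z, D z = Q z * E z := by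
  classical
  refine ⟨fun z => if E z = 0 then deriv D z / deriv E z else D z / E z, fun b => ?_, fun z => ?_⟩
  · by_cases hb : E b = 0
    · have h1 : DifferentiableAt ℂ (fun z => dslope D b z / dslope E b z) b := by
        refine DifferentiableAt.div ?_ ?_ (by simpa using hsimple b hb)
        · exact ((Complex.differentiableOn_dslope univ_mem).2 hD.differentiableOn).differentiableAt
            univ_mem
        · exact ((Complex.differentiableOn_dslope univ_mem).2 hE.differentiableOn).differentiableAt
            univ_mem
      refine h1.congr_of_eventuallyEq ?_
      have hne : ∀ᶠ z in 𝓝 b, dslope E b z ≠ 0 := by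
        have : ContinuousAt (dslope E b) b :=
          continuousAt_dslope_same.2 (hE b)
        exact this.eventually_ne (by simpa using hsimple b hb)
      filter_upwards [hne] with z hz
      by_cases hzb : z = b
      · subst hzb
        simp [hb]
      · have hEz : E z ≠ 0 := by
          intro h
          apply hz
          simp [dslope_of_ne _ hzb, slope, h, hb]
        have : z - b ≠ 0 := sub_ne_zero.2 hzb
        simp only [hEz, if_false, dslope_of_ne _ hzb, slope, vsub_eq_sub, hb, hzero b hb,
          sub_zero, smul_eq_mul]
        field_simp
    · have h1 : DifferentiableAt ℂ (fun z => D z / E z) b := (hD b).div (hE b) hb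
      refine h1.congr_of_eventuallyEq ?_
      filter_upwards [(hE b).continuousAt.eventually_ne hb] with z hz
      simp [hz]
  · by_cases hz : E z = 0
    · simp [hz, hzero z hz]
    · simp [hz]

theorem one_le_two_mul_norm_exp_add_one {N : ℕ} {z : ℂ} (hN : 1 ≤ N)
    (hz : (|z.re| = 2 * Real.pi * N) ∨ |z.im| = 2 * Real.pi * N) :
    max 1 (Real.exp (-z.im)) ≤ 2 * ‖Complex.exp (Complex.I * z) + 1‖ := by
  have hnorm : ‖Complex.exp (Complex.I * z)‖ = Real.exp (-z.im) := by
    simp [Complex.norm_exp]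
  rcases hz with h | h
  · have hre : Complex.exp (Complex.I * z) = (Real.exp (-z.im) : ℂ) := by
      have hper : Complex.exp (Complex.I * (z.re : ℂ)) = 1 := by
        rw [Complex.exp_eq_one_iff]
        rcases abs_choice z.re with h' | h'
        · refine ⟨N, ?_⟩
          rw [h'] at h; rw [h]; push_cast; ring
        · refine ⟨-N, ?_⟩
          have : z.re = - (2 * Real.pi * N) := by linarith
          rw [this]; push_cast; ring
      conv_lhs => rw [← Complex.re_add_im z, mul_add, Complex.exp_add, hper]
      rw [one_mul, Complex.ofReal_exp]
      congr 1
      push_cast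
      linear_combination (z.im : ℂ) * Complex.I_mul_I
    rw [hre]
    have : ((Real.exp (-z.im) : ℝ) : ℂ) + 1 = ((Real.exp (-z.im) + 1 : ℝ) : ℂ) := by push_cast; ring
    rw [this, Complex.norm_real, Real.norm_of_nonneg (by positivity)]
    have := Real.exp_pos (-z.im)
    apply max_le <;> linarith
  · have h2 : 1 ≤ |z.im| := by
      rw [h]
      have : (1 : ℝ) ≤ N := by exact_mod_cast hN
      nlinarith [Real.pi_gt_three]
    have hpos := Real.exp_pos (-z.im)
    rcases le_abs.1 h2 with h' | h'
    · have h3 : Real.exp (-z.im) ≤ 1 / 2 := by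
        have h4 : 2 ≤ Real.exp z.im := by linarith [Real.add_one_le_exp z.im]
        rw [Real.exp_neg, one_div]
        exact inv_anti₀ (by norm_num) h4
      have h5 := norm_sub_norm_le (1 : ℂ) (-Complex.exp (Complex.I * z))
      rw [norm_neg, hnorm, norm_one, sub_neg_eq_add, add_comm (1 : ℂ)] at h5
      apply max_le <;> linarith
    · have h4 : 2 ≤ Real.exp (-z.im) := by linarith [Real.add_one_le_exp (-z.im)]
      have h5 := norm_sub_norm_le (Complex.exp (Complex.I * z)) (-1)
      rw [norm_neg, hnorm, norm_one, sub_neg_eq_add] at h5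
      apply max_le <;> linarith

/-- An entire function of exponential type with spectrum in `[0, 1]` that vanishes at the zeros of
`exp (I * z) + 1` and tends to zero along the positive imaginary axis is zero. -/
theorem eq_zero_of_eq_zero_of_exp_eq_neg_one {D : ℂ → ℂ} (hD : Differentiable ℂ D) {K : ℝ}
    (hup : ∀ z : ℂ, 1 ≤ ‖z‖ → 0 ≤ z.im → ‖D z‖ ≤ K)
    (hlow : ∀ z : ℂ, 1 ≤ ‖z‖ → z.im ≤ 0 → ‖D z‖ ≤ K * Real.exp (-z.im))
    (hzero : ∀ z, Complex.exp (Complex.I * z) = -1 → D z = 0)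
    (hlim : Tendsto (fun t : ℝ => D (Complex.I * t)) atTop (𝓝 0)) (z : ℂ) : D z = 0 := by
  have hderiv : ∀ z, HasDerivAt (fun z => Complex.exp (Complex.I * z) + 1)
      (Complex.exp (Complex.I * z) * Complex.I) z := fun z => by
    simpa using (((hasDerivAt_id z).const_mul Complex.I).cexp).add_const (1 : ℂ)
  obtain ⟨Q, hQ, hDQ⟩ := exists_differentiable_quotient hD
    (E := fun z => Complex.exp (Complex.I * z) + 1) (fun z => (hderiv z).differentiableAt)
    (fun z _ => by rw [(hderiv z).deriv]; simp [Complex.exp_ne_zero])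
    (fun z hz => hzero z (eq_neg_of_add_eq_zero_left hz))
  have hK : 0 ≤ K := (norm_nonneg _).trans (hup 1 (by simp) (by simp))
  have hbound : ∀ w, ‖Q w‖ ≤ 2 * K := by
    intro w
    obtain ⟨N, hN⟩ := exists_nat_gt ‖w‖
    have hN1 : 1 ≤ N := by
      by_contra h
      have : N = 0 := by omega
      subst this
      simp at hN
      exact absurd (norm_nonneg w) (not_le.2 hN)
    set R : ℝ := 2 * Real.pi * N with hR
    have hN' : (1 : ℝ) ≤ N := by exact_mod_cast hN1
    have hRN : (N : ℝ) ≤ R := by rw [hR]; nlinarith [Real.pi_gt_three]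
    have hbd : Bornology.IsBounded (Ioo (-R) R ×ℂ Ioo (-R) R) :=
      Bornology.IsBounded.reProdIm (Metric.isBounded_Ioo _ _) (Metric.isBounded_Ioo _ _)
    refine Complex.norm_le_of_forall_mem_frontier_norm_le hbd hQ.diffContOnCl ?_
      (subset_closure ?_)
    · intro z hz
      rw [Complex.frontier_reProdIm, frontier_Ioo (by linarith), closure_Ioo (by linarith)] at hz
      have hz' : |z.re| = R ∨ |z.im| = R := by
        have key : ∀ x : ℝ, x ∈ ({-R, R} : Set ℝ) → |x| = R := by
          rintro x (rfl | rfl)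
          · rw [abs_neg, abs_of_nonneg (by linarith)]
          · rw [abs_of_nonneg (by linarith)]
        rcases hz with h | h
        · exact Or.inr (key _ h.2)
        · exact Or.inl (key _ h.1)
      have hz1 : 1 ≤ ‖z‖ := by
        rcases hz' with h | h
        · linarith [Complex.abs_re_le_norm z]
        · linarith [Complex.abs_im_le_norm z]
      have hE := one_le_two_mul_norm_exp_add_one hN1 hz'
      have hDE : ‖D z‖ ≤ K * max 1 (Real.exp (-z.im)) := by
        rcases le_total 0 z.im with h | h
        · refine (hup z hz1 h).trans ?_
          nlinarith [le_max_left 1 (Real.exp (-z.im))]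
        · refine (hlow z hz1 h).trans ?_
          gcongr
          exact le_max_right _ _
      have hmax : 1 ≤ max 1 (Real.exp (-z.im)) := le_max_left _ _
      have hpos : 0 < ‖Complex.exp (Complex.I * z) + 1‖ := by linarith
      refine le_of_mul_le_mul_right ?_ hpos
      rw [← norm_mul, ← hDQ z]
      nlinarith
    · rw [Complex.mem_reProdIm]
      constructor
      · exact abs_lt.1 (by linarith [Complex.abs_re_le_norm w])
      · exact abs_lt.1 (by linarith [Complex.abs_im_le_norm w])
  obtain ⟨c, hc⟩ := hQ.exists_const_forall_eq_of_bounded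
    (isBounded_iff_forall_norm_le.2 ⟨2 * K, by rintro _ ⟨w, rfl⟩; exact hbound w⟩)
  have hlimE : Tendsto (fun t : ℝ => D (Complex.I * t)) atTop (𝓝 c) := by
    have h1 : Tendsto (fun t : ℝ => c * ((Real.exp (-t) : ℂ) + 1)) atTop
        (𝓝 (c * (((0 : ℝ) : ℂ) + 1))) :=
      (((Complex.continuous_ofReal.tendsto 0).comp
        Real.tendsto_exp_neg_atTop_nhds_zero).add_const 1).const_mul c
    simp only [Complex.ofReal_zero, zero_add, mul_one] at h1
    refine h1.congr fun t => ?_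
    rw [hDQ, hc, Complex.ofReal_exp]
    congr 3
    push_cast
    linear_combination (-(t : ℂ)) * Complex.I_mul_I
  rw [hDQ, hc, tendsto_nhds_unique hlimE hlim, zero_mul]

open AddCircle in
/-- The function `t ↦ exp (I * t * z)` on `(0, 1]`, transported to the unit circle. -/
noncomputable def circleExp (z : ℂ) (x : UnitAddCircle) : ℂ :=
  Complex.exp (Complex.I * ((equivIoc (1 : ℝ) 0 x : ℝ) : ℂ) * z)

theorem measurable_circleExp (z : ℂ) : Measurable (circleExp z) := by
  have h : Measurable fun x : UnitAddCircle => (AddCircle.equivIoc (1 : ℝ) 0 x : ℝ) :=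
    measurable_subtype_coe.comp (AddCircle.measurableEquivIoc (1 : ℝ) 0).measurable
  unfold circleExp
  fun_prop

theorem equivIoc_mem_Ioc_zero_one (x : UnitAddCircle) :
    (AddCircle.equivIoc (1 : ℝ) 0 x : ℝ) ∈ Ioc (0 : ℝ) 1 := by
  simpa using (AddCircle.equivIoc (1 : ℝ) 0 x).2

theorem norm_circleExp (z : ℂ) (x : UnitAddCircle) :
    ‖circleExp z x‖ = Real.exp (-((AddCircle.equivIoc (1 : ℝ) 0 x : ℝ) * z.im)) := by
  simp [circleExp, Complex.norm_exp]

theorem norm_circleExp_ofReal (a : ℝ) (x : UnitAddCircle) : ‖circleExp a x‖ = 1 := by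
  simp [norm_circleExp]

theorem norm_circleExp_le_exp_norm (z : ℂ) (x : UnitAddCircle) :
    ‖circleExp z x‖ ≤ Real.exp ‖z‖ := by
  rw [norm_circleExp, Real.exp_le_exp]
  obtain ⟨h0, h1⟩ := equivIoc_mem_Ioc_zero_one x
  have := neg_le_of_abs_le (Complex.abs_im_le_norm z)
  nlinarith [norm_nonneg z]

theorem circleExp_add (z w : ℂ) (x : UnitAddCircle) :
    circleExp (z + w) x = circleExp z x * circleExp w x := by
  rw [circleExp, circleExp, circleExp, ← Complex.exp_add, mul_add]

theorem conj_circleExp_ofReal (a : ℝ) (x : UnitAddCircle) :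
    (starRingEnd ℂ) (circleExp a x) = circleExp (-a) x := by
  simp [circleExp, ← Complex.exp_conj]

theorem fourier_eq_circleExp (n : ℤ) (x : UnitAddCircle) :
    fourier n x = circleExp ((2 * Real.pi * n : ℝ) : ℂ) x := by
  conv_lhs => rw [← AddCircle.coe_equivIoc (p := (1 : ℝ)) (a := 0) (y := x)]
  rw [fourier_coe_apply, circleExp]
  congr 1
  push_cast
  ring

open AddCircle in
/-- The Fourier–Laplace transform of a function on `(0, 1]`. -/
noncomputable def circleTransform (φ : UnitAddCircle → ℂ) (z : ℂ) : ℂ :=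
  ∫ x, circleExp z x * φ x ∂haarAddCircle

theorem fourierCoeff_eq_circleTransform (φ : UnitAddCircle → ℂ) (n : ℤ) :
    fourierCoeff φ n = circleTransform φ ((-(2 * Real.pi * n) : ℝ) : ℂ) := by
  simp only [fourierCoeff, circleTransform, fourier_eq_circleExp, smul_eq_mul]
  push_cast
  simp

theorem circleTransform_add (φ : UnitAddCircle → ℂ) (z w : ℂ) :
    circleTransform φ (z + w) = circleTransform (fun x => circleExp w x * φ x) z := by
  simp only [circleTransform, circleExp_add, mul_assoc]

theorem circleTransform_circleExp (z w : ℂ) :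
    circleTransform (circleExp w) z = circleTransform 1 (z + w) := by
  rw [circleTransform_add]
  simp

theorem circleTransform_one_eq_sincFac (σ : ℝ) (n : ℤ) (y : ℝ) :
    circleTransform 1 ((σ * y - 2 * Real.pi * n : ℝ) : ℂ) = sincFac σ n y := by
  set a : ℝ := σ * y - 2 * Real.pi * n with ha
  have h1 : circleTransform 1 (a : ℂ) = ∫ t in (0 : ℝ)..1, Complex.exp ((Complex.I * a) * t) := by
    rw [circleTransform, AddCircle.integral_haarAddCircle, inv_one, one_smul,
      ← AddCircle.intervalIntegral_preimage 1 0, zero_add]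
    refine intervalIntegral.integral_congr_ae (.of_forall fun t ht => ?_)
    rw [uIoc_of_le zero_le_one] at ht
    rw [circleExp, AddCircle.equivIoc_coe_of_mem (p := (1 : ℝ)) (a := 0) (by simpa using ht)]
    simp only [Pi.one_apply, mul_one]
    congr 1
    ring
  rw [h1, sincFac]
  split_ifs with h
  · have : a = 0 := by rw [ha, h, sub_self]
    simp [this]
  · have ha0 : a ≠ 0 := sub_ne_zero.2 h
    rw [integral_exp_mul_complex (by simp [ha0])]
    have hexp : Complex.exp (Complex.I * a) = Complex.exp (Complex.I * ((σ * y : ℝ) : ℂ)) := by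
      rw [Complex.exp_eq_exp_iff_exists_int]
      refine ⟨-n, ?_⟩
      rw [ha]; push_cast; ring
    simp only [Complex.ofReal_one, mul_one, Complex.ofReal_zero, mul_zero, Complex.exp_zero, hexp]
    rw [ha]
    push_cast
    rfl

section L2

open AddCircle

variable {φ ψ : UnitAddCircle → ℂ}

theorem hasSum_sq_norm_fourierCoeff_of_memLp (hφ : MemLp φ 2 haarAddCircle) :
    HasSum (fun n => ‖fourierCoeff φ n‖ ^ 2) (∫ x, ‖φ x‖ ^ 2 ∂haarAddCircle) := by
  convert hasSum_sq_fourierCoeff (hφ.toLp φ) using 1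
  · funext n
    rw [fourierCoeff_congr_ae hφ.coeFn_toLp]
  · refine integral_congr_ae ?_
    filter_upwards [hφ.coeFn_toLp] with x hx
    rw [hx]

theorem hasSum_conj_fourierCoeff_mul_fourierCoeff (hφ : MemLp φ 2 haarAddCircle)
    (hψ : MemLp ψ 2 haarAddCircle) :
    HasSum (fun n => (starRingEnd ℂ) (fourierCoeff φ n) * fourierCoeff ψ n)
      (∫ x, (starRingEnd ℂ) (φ x) * ψ x ∂haarAddCircle) := by
  have hterm : ∀ n, inner ℂ (hφ.toLp φ) (fourierBasis n) * inner ℂ (fourierBasis n) (hψ.toLp ψ) =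
      (starRingEnd ℂ) (fourierCoeff φ n) * fourierCoeff ψ n := fun n => by
    rw [← inner_conj_symm, ← fourierBasis.repr_apply_apply, ← fourierBasis.repr_apply_apply,
      fourierBasis_repr, fourierBasis_repr, fourierCoeff_congr_ae hφ.coeFn_toLp,
      fourierCoeff_congr_ae hψ.coeFn_toLp]
  have hval : inner ℂ (hφ.toLp φ) (hψ.toLp ψ) =
      ∫ x, (starRingEnd ℂ) (φ x) * ψ x ∂haarAddCircle := by
    rw [L2.inner_def]
    refine integral_congr_ae ?_
    filter_upwards [hφ.coeFn_toLp, hψ.coeFn_toLp] with x hx hx'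
    rw [hx, hx', RCLike.inner_apply']
  rw [← hval, ← funext hterm]
  exact fourierBasis.hasSum_inner_mul_inner (hφ.toLp φ) (hψ.toLp ψ)

theorem exists_memLp_fourierCoeff_eq {c : ℤ → ℂ} (hc : Summable fun n => ‖c n‖ ^ 2) :
    ∃ φ : UnitAddCircle → ℂ, MemLp φ 2 haarAddCircle ∧ ∀ n, fourierCoeff φ n = c n := by
  have hmem : Memℓp c 2 := memℓp_gen (by simpa using hc)
  refine ⟨fourierBasis.repr.symm ⟨c, hmem⟩, Lp.memLp _, fun n => ?_⟩
  rw [← fourierBasis_repr, LinearIsometryEquiv.apply_symm_apply]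

theorem memLp_circleExp_ofReal_mul (hφ : MemLp φ 2 haarAddCircle) (a : ℝ) :
    MemLp (fun x => circleExp a x * φ x) 2 haarAddCircle :=
  hφ.of_le ((measurable_circleExp a).aestronglyMeasurable.mul hφ.1)
    (.of_forall fun x => by rw [norm_mul, norm_circleExp_ofReal, one_mul])

theorem memLp_circleExp (z : ℂ) : MemLp (circleExp z) 2 haarAddCircle :=
  .of_bound (measurable_circleExp z).aestronglyMeasurable _
    (.of_forall (norm_circleExp_le_exp_norm z))

theorem hasSum_sq_norm_circleTransform (hφ : MemLp φ 2 haarAddCircle) (a : ℝ) :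
    HasSum (fun n : ℤ => ‖circleTransform φ ((2 * Real.pi * n + a : ℝ) : ℂ)‖ ^ 2)
      (∫ x, ‖φ x‖ ^ 2 ∂haarAddCircle) := by
  have h := hasSum_sq_norm_fourierCoeff_of_memLp (memLp_circleExp_ofReal_mul hφ a)
  simp only [norm_mul, norm_circleExp_ofReal, one_mul] at h
  rw [← (Equiv.neg ℤ).hasSum_iff] at h
  convert h using 1
  funext n
  rw [Function.comp_apply, fourierCoeff_eq_circleTransform, ← circleTransform_add]
  simp

theorem hasSum_circleTransform_mul_sincFac (hφ : MemLp φ 2 haarAddCircle) (a σ y : ℝ) :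
    HasSum (fun n : ℤ => circleTransform φ ((2 * Real.pi * n + a : ℝ) : ℂ) * sincFac σ n y)
      (circleTransform φ ((σ * y + a : ℝ) : ℂ)) := by
  have h := hasSum_conj_fourierCoeff_mul_fourierCoeff (memLp_circleExp ((-(σ * y) : ℝ) : ℂ))
    (memLp_circleExp_ofReal_mul hφ a)
  rw [← (Equiv.neg ℤ).hasSum_iff] at h
  have hconj : ∀ b : ℝ, (starRingEnd ℂ) (circleTransform 1 (b : ℂ)) =
      circleTransform 1 ((-b : ℝ) : ℂ) := fun b => by
    simp only [circleTransform, ← integral_conj, Pi.one_apply, mul_one, conj_circleExp_ofReal]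
    push_cast; rfl
  convert h using 1
  · funext n
    rw [Function.comp_apply, fourierCoeff_eq_circleTransform, fourierCoeff_eq_circleTransform,
      ← circleTransform_add, circleTransform_circleExp, ← Complex.ofReal_add, hconj,
      ← circleTransform_one_eq_sincFac, mul_comm]
    congr 2
    · push_cast [Equiv.neg_apply]; ring
    · push_cast [Equiv.neg_apply]; ring
  · rw [Complex.ofReal_add, circleTransform_add, circleTransform]
    simp only [conj_circleExp_ofReal]
    push_cast
    simp

theorem hasSum_sq_norm_sincFac (σ y : ℝ) : HasSum (fun n : ℤ => ‖sincFac σ n y‖ ^ 2) 1 := by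
  have h := hasSum_sq_norm_fourierCoeff_of_memLp (memLp_circleExp ((σ * y : ℝ) : ℂ))
  simp only [norm_circleExp_ofReal] at h
  convert h using 1
  · funext n
    rw [fourierCoeff_eq_circleTransform, circleTransform_circleExp, ← Complex.ofReal_add,
      ← circleTransform_one_eq_sincFac]
    congr 4
    ring
  · simp

theorem differentiable_circleTransform (hφ : Integrable φ haarAddCircle) :
    Differentiable ℂ (circleTransform φ) := by
  intro z₀
  refine (hasDerivAt_integral_of_dominated_loc_of_deriv_le
    (F := fun z x => circleExp z x * φ x)
    (F' := fun z x => Complex.I * ((equivIoc (1 : ℝ) 0 x : ℝ) : ℂ) * circleExp z x * φ x)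
    (bound := fun x => Real.exp (‖z₀‖ + 1) * ‖φ x‖) (Metric.ball_mem_nhds z₀ one_pos)
    (.of_forall fun z => (measurable_circleExp z).aestronglyMeasurable.mul hφ.1)
    ?_ ?_ ?_ (hφ.norm.const_mul _) ?_).2.differentiableAt
  · exact hφ.bdd_mul (measurable_circleExp z₀).aestronglyMeasurable
      (.of_forall (norm_circleExp_le_exp_norm z₀))
  · have h : Measurable fun x : UnitAddCircle => (AddCircle.equivIoc (1 : ℝ) 0 x : ℝ) :=
      measurable_subtype_coe.comp (AddCircle.measurableEquivIoc (1 : ℝ) 0).measurable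
    refine AEStronglyMeasurable.mul (Measurable.aestronglyMeasurable ?_) hφ.1
    have := measurable_circleExp z₀
    fun_prop
  · refine .of_forall fun x z hz => ?_
    obtain ⟨h0, h1⟩ := equivIoc_mem_Ioc_zero_one x
    rw [norm_mul, norm_mul, norm_mul, Complex.norm_I, one_mul, Complex.norm_real,
      Real.norm_of_nonneg h0.le]
    gcongr
    have h2 : ‖z‖ ≤ ‖z₀‖ + 1 := by
      have := norm_sub_norm_le z z₀
      rw [mem_ball_iff_norm] at hz
      linarith
    calc _ ≤ 1 * Real.exp ‖z‖ := by
          gcongr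
          exact norm_circleExp_le_exp_norm z x
      _ ≤ _ := by rw [one_mul]; exact Real.exp_le_exp.2 h2
  · refine .of_forall fun x z _ => ?_
    have := (((hasDerivAt_id z).const_mul
      (Complex.I * ((equivIoc (1 : ℝ) 0 x : ℝ) : ℂ))).cexp).mul_const (φ x)
    simp only [id, mul_one] at this
    refine this.congr_deriv ?_
    rw [circleExp]
    ring

theorem norm_circleTransform_le (hφ : Integrable φ haarAddCircle) {z : ℂ} {B : ℝ}
    (hB : ∀ x, ‖circleExp z x‖ ≤ B) :
    ‖circleTransform φ z‖ ≤ (∫ x, ‖φ x‖ ∂haarAddCircle) * B := by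
  rw [mul_comm, ← integral_const_mul]
  refine norm_integral_le_of_norm_le (hφ.norm.const_mul B) (.of_forall fun x => ?_)
  rw [norm_mul]
  gcongr
  exact hB x

theorem tendsto_circleTransform_I_mul (hφ : Integrable φ haarAddCircle) :
    Tendsto (fun t : ℝ => circleTransform φ (Complex.I * t)) atTop (𝓝 0) := by
  have h0 : (∫ _ : UnitAddCircle, (0 : ℂ) ∂haarAddCircle) = 0 := integral_zero _ _
  rw [← h0]
  have hnorm : ∀ (t : ℝ) (x : UnitAddCircle), ‖circleExp (Complex.I * t) x‖ =
      Real.exp (-((equivIoc (1 : ℝ) 0 x : ℝ) * t)) := fun t x => by simp [norm_circleExp]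
  refine tendsto_integral_filter_of_dominated_convergence (fun x => ‖φ x‖)
    (.of_forall fun t => (measurable_circleExp _).aestronglyMeasurable.mul hφ.1) ?_ hφ.norm ?_
  · filter_upwards [eventually_ge_atTop 0] with t ht
    refine .of_forall fun x => ?_
    rw [norm_mul, hnorm]
    refine mul_le_of_le_one_left (norm_nonneg _) (Real.exp_le_one_iff.2 ?_)
    have := mul_nonneg (equivIoc_mem_Ioc_zero_one x).1.le ht
    linarith
  · refine .of_forall fun x => ?_
    rw [tendsto_zero_iff_norm_tendsto_zero]
    simp only [norm_mul, hnorm]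
    have h := (Real.tendsto_exp_neg_atTop_nhds_zero.comp
      (tendsto_id.const_mul_atTop (equivIoc_mem_Ioc_zero_one x).1)).mul_const ‖φ x‖
    rwa [zero_mul] at h

end L2

theorem norm_sincFac_one_pi (n : ℤ) : ‖sincFac 1 n Real.pi‖ = 2 / |Real.pi - 2 * Real.pi * n| := by
  have hne : (1 : ℝ) * Real.pi ≠ 2 * Real.pi * n := fun h => by
    have h1 : Real.pi * (1 - 2 * n) = 0 := by linarith
    have h2 : (1 : ℝ) - 2 * n = 0 := (mul_eq_zero.1 h1).resolve_left Real.pi_ne_zero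
    have h3 : (1 : ℤ) - 2 * n = 0 := by exact_mod_cast h2
    omega
  rw [sincFac, if_neg hne, norm_div, norm_mul, Complex.norm_I, one_mul, ← Complex.ofReal_sub,
    Complex.norm_real, one_mul, mul_comm Complex.I, Complex.exp_pi_mul_I, Real.norm_eq_abs]
  norm_num

theorem exp_I_mul_eq_neg_one_iff {z : ℂ} :
    Complex.exp (Complex.I * z) = -1 ↔ ∃ n : ℤ, z = ((Real.pi - 2 * Real.pi * n : ℝ) : ℂ) := by
  rw [← Complex.exp_pi_mul_I, Complex.exp_eq_exp_iff_exists_int]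
  constructor
  · rintro ⟨n, hn⟩
    refine ⟨-n, mul_left_cancel₀ Complex.I_ne_zero ?_⟩
    rw [hn]; push_cast; ring
  · rintro ⟨n, rfl⟩
    refine ⟨-n, ?_⟩
    push_cast; ring

open AddCircle in
/-- A Paley–Wiener theorem for the difference quotient at the origin of a function which is bounded
on the real line and has spectrum in `[0, 1]`. -/
theorem exists_circleTransform_eq_dslope {G : ℂ → ℂ} (hG : MemEInftyPlus 1 G) {M : ℝ}
    (hM : ∀ x : ℝ, ‖G x‖ ≤ M) :
    ∃ φ : UnitAddCircle → ℂ, MemLp φ 2 haarAddCircle ∧ ∫ x, ‖φ x‖ ^ 2 ∂haarAddCircle ≤ M ^ 2 ∧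
      ∀ z, circleTransform φ z = dslope G 0 z := by
  obtain ⟨hGd, ⟨C₁, hC₁⟩, C₂, hC₂⟩ := hG
  have hbound : ∀ n : ℤ, ‖dslope G 0 ((Real.pi - 2 * Real.pi * n : ℝ) : ℂ)‖ ^ 2 ≤
      M ^ 2 * ‖sincFac 1 n Real.pi‖ ^ 2 := by
    intro n
    rw [← mul_pow]
    refine pow_le_pow_left₀ (norm_nonneg _) ?_ 2
    have hne : Real.pi - 2 * Real.pi * n ≠ 0 := fun h => by
      have := exp_I_mul_eq_neg_one_iff.2 ⟨n, rfl⟩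
      rw [h] at this
      norm_num at this
    rw [norm_sincFac_one_pi, dslope_of_ne _ (by exact_mod_cast hne), slope, vsub_eq_sub, sub_zero,
      norm_smul, norm_inv, Complex.norm_real, Real.norm_eq_abs, inv_mul_eq_div, ← mul_div_assoc]
    gcongr
    have h1 := hM (Real.pi - 2 * Real.pi * n)
    have h2 := hM 0
    rw [Complex.ofReal_zero] at h2
    exact (norm_sub_le _ _).trans (by linarith)
  have hsum := (hasSum_sq_norm_sincFac 1 Real.pi).mul_left (M ^ 2)
  obtain ⟨ψ, hψ, hψc⟩ := exists_memLp_fourierCoeff_eq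
    (c := fun n : ℤ => dslope G 0 ((Real.pi - 2 * Real.pi * n : ℝ) : ℂ))
    (.of_nonneg_of_le (fun _ => by positivity) hbound hsum.summable)
  have hφ := memLp_circleExp_ofReal_mul hψ (-Real.pi)
  set φ : UnitAddCircle → ℂ := fun x => circleExp ((-Real.pi : ℝ) : ℂ) x * ψ x with hφdef
  have hφi : Integrable φ haarAddCircle := hφ.integrable one_le_two
  refine ⟨φ, hφ, ?_, fun z => ?_⟩
  · simp only [hφdef, norm_mul, norm_circleExp_ofReal, one_mul]
    have h := hasSum_le (fun n => ?_) (hasSum_sq_norm_fourierCoeff_of_memLp hψ) hsum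
    · simpa using h
    · rw [hψc]
      exact hbound n
  set A := ∫ x, ‖φ x‖ ∂haarAddCircle with hA
  set B := max C₁ C₂ + ‖G 0‖ with hB
  have hdslope : ∀ z : ℂ, z ≠ 0 → ‖dslope G 0 z‖ = ‖G z - G 0‖ / ‖z‖ := fun z hz => by
    rw [dslope_of_ne _ hz, slope, vsub_eq_sub, sub_zero, norm_smul, norm_inv, inv_mul_eq_div]
  have hup : ∀ z : ℂ, 0 ≤ z.im → ‖G z - G 0‖ ≤ B := fun z hz =>
    (norm_sub_le _ _).trans (by have := hC₁ z hz; have := le_max_left C₁ C₂; linarith)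
  have hlow : ∀ z : ℂ, z.im ≤ 0 → ‖G z - G 0‖ ≤ B * Real.exp (-z.im) := fun z hz => by
    have h1 := hC₂ z hz
    rw [norm_mul] at h1
    have h2 : ‖Complex.exp (-(Complex.I * ((1 : ℝ) : ℂ) * z))‖ = Real.exp z.im := by
      simp [Complex.norm_exp]
    rw [h2, mul_comm, ← le_div_iff₀ (Real.exp_pos _), div_eq_mul_inv, ← Real.exp_neg] at h1
    have h3 : 1 ≤ Real.exp (-z.im) := Real.one_le_exp (by linarith)
    refine (norm_sub_le _ _).trans ?_
    have h4 : C₂ * Real.exp (-z.im) ≤ max C₁ C₂ * Real.exp (-z.im) := by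
      gcongr
      exact le_max_right _ _
    have h5 : ‖G 0‖ * 1 ≤ ‖G 0‖ * Real.exp (-z.im) := by gcongr
    rw [hB, add_mul]
    linarith
  have hdiv : ∀ {z : ℂ}, 1 ≤ ‖z‖ → ‖dslope G 0 z‖ ≤ ‖G z - G 0‖ := fun {z} hz => by
    rw [hdslope z (norm_pos_iff.1 (by linarith))]
    exact div_le_self (norm_nonneg _) hz
  refine (sub_eq_zero.1 ?_).symm
  refine eq_zero_of_eq_zero_of_exp_eq_neg_one (D := fun z => dslope G 0 z - circleTransform φ z)
    (K := B + A) ?_ ?_ ?_ ?_ ?_ z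
  · refine Differentiable.sub ?_ (differentiable_circleTransform hφi)
    exact differentiableOn_univ.1 ((Complex.differentiableOn_dslope univ_mem).2 hGd.differentiableOn)
  · intro z hz1 hz
    refine (norm_sub_le _ _).trans (add_le_add ((hdiv hz1).trans (hup z hz)) ?_)
    refine (norm_circleTransform_le hφi fun x => ?_).trans_eq (mul_one A)
    rw [norm_circleExp, Real.exp_le_one_iff]
    have := mul_nonneg (equivIoc_mem_Ioc_zero_one x).1.le hz
    linarith
  · intro z hz1 hz
    rw [add_mul]
    refine (norm_sub_le _ _).trans (add_le_add ((hdiv hz1).trans (hlow z hz)) ?_)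
    refine norm_circleTransform_le hφi fun x => ?_
    rw [norm_circleExp, Real.exp_le_exp]
    nlinarith [(equivIoc_mem_Ioc_zero_one x).2]
  · intro z hz
    obtain ⟨n, rfl⟩ := exp_I_mul_eq_neg_one_iff.1 hz
    rw [sub_eq_zero, ← hψc n, fourierCoeff_eq_circleTransform, hφdef, ← circleTransform_add,
      ← Complex.ofReal_add]
    congr 2
    ring
  · suffices h : Tendsto (fun t : ℝ => dslope G 0 (Complex.I * t)) atTop (𝓝 0) by
      simpa using h.sub (tendsto_circleTransform_I_mul hφi)
    refine squeeze_zero_norm' ?_ (tendsto_const_nhds.div_atTop (a := B) tendsto_id)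
    filter_upwards [eventually_gt_atTop 0] with t ht
    have hne : Complex.I * (t : ℂ) ≠ 0 :=
      mul_ne_zero Complex.I_ne_zero (by exact_mod_cast ht.ne')
    have hnorm : ‖Complex.I * (t : ℂ)‖ = t := by simp [abs_of_pos ht]
    rw [hdslope _ hne, hnorm, id]
    gcongr
    exact hup _ (by simp [ht.le])

/-- Rescaling and translating the variable turns spectrum in `[0, σ]` into spectrum in `[0, 1]`. -/
theorem MemEInftyPlus.comp_add_div {σ : ℝ} (hσ : 0 < σ) {g : ℂ → ℂ} (hg : MemEInftyPlus σ g)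
    (a : ℝ) : MemEInftyPlus 1 fun z => g (a + z / σ) := by
  obtain ⟨hd, ⟨C₁, hC₁⟩, C₂, hC₂⟩ := hg
  have him : ∀ z : ℂ, (a + z / σ : ℂ).im = z.im / σ := fun z => by
    simp [Complex.div_ofReal_im]
  refine ⟨hd.comp (by fun_prop), ⟨C₁, fun z hz => hC₁ _ (by rw [him]; positivity)⟩, C₂,
    fun z hz => ?_⟩
  refine le_of_eq_of_le ?_ (hC₂ (a + z / σ) (by
    rw [him]; exact div_nonpos_of_nonpos_of_nonneg hz hσ.le))
  rw [norm_mul, norm_mul, Complex.norm_exp, Complex.norm_exp]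
  congr 2
  have h : (Complex.I * (σ : ℂ) * (a + z / σ)).re = -(σ * (a + z / σ : ℂ).im) := by
    simp [mul_assoc]
  rw [Complex.neg_re, Complex.neg_re, h, him, mul_div_cancel₀ _ hσ.ne']
  simp

/-- Haagerup-type expansion of the divided difference in the second variable: for `f`
sectionally in `(ℰ_σ^∞)₊(ℝ²)` bounded by `M`, and `y₁ ≠ y₂` with `σy₁ ∉ 2πℤ`, the series
`∑_{n∈ℤ} σ(f(x₁,y₁) − f(x₁, 2πn/σ))/(σy₁ − 2πn) · (e^{iσy₂} − 1)/(i(σy₂ − 2πn))` converges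
absolutely to `(f(x₁,y₁) − f(x₁,y₂))/(y₁ − y₂)`; moreover
`∑_{n∈ℤ} σ²|f(x₁,y₁) − f(x₁, 2πn/σ)|²/(σy₁ − 2πn)² ≤ (4/π)σ²M²` and
`∑_{n∈ℤ} |e^{iσy₂} − 1|²/(σy₂ − 2πn)² = 1`, which together give a Haagerup-type
factorization with constant `(2/√π)σM`. -/
theorem divided_difference_second_variable (σ : ℝ) (hσ : 0 < σ) (f : ℂ → ℂ → ℂ)
    (hf : SectEInftyPlus σ f) (M : ℝ) (hM : ∀ x y : ℝ, ‖f (x : ℂ) (y : ℂ)‖ ≤ M)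
    (x₁ y₁ y₂ : ℝ) (hy : y₁ ≠ y₂) (hy₁ : ∀ n : ℤ, σ * y₁ ≠ 2 * Real.pi * n) :
    Summable (fun n : ℤ =>
      ‖((σ : ℂ) * (f (x₁ : ℂ) (y₁ : ℂ) - f (x₁ : ℂ) ((2 * Real.pi * n / σ : ℝ) : ℂ)) /
          ((σ * y₁ - 2 * Real.pi * n : ℝ) : ℂ)) * sincFac σ n y₂‖) ∧
    HasSum (fun n : ℤ =>
      ((σ : ℂ) * (f (x₁ : ℂ) (y₁ : ℂ) - f (x₁ : ℂ) ((2 * Real.pi * n / σ : ℝ) : ℂ)) /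
          ((σ * y₁ - 2 * Real.pi * n : ℝ) : ℂ)) * sincFac σ n y₂)
      ((f (x₁ : ℂ) (y₁ : ℂ) - f (x₁ : ℂ) (y₂ : ℂ)) / ((y₁ : ℂ) - (y₂ : ℂ))) ∧
    (∃ S : ℝ,
      HasSum (fun n : ℤ =>
        σ ^ 2 * ‖f (x₁ : ℂ) (y₁ : ℂ) - f (x₁ : ℂ) ((2 * Real.pi * n / σ : ℝ) : ℂ)‖ ^ 2 /
          (σ * y₁ - 2 * Real.pi * n) ^ 2) S ∧
      S ≤ (4 / Real.pi) * σ ^ 2 * M ^ 2) ∧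
    HasSum (fun n : ℤ => ‖sincFac σ n y₂‖ ^ 2) 1 := by
  obtain ⟨φ, hφ, hφM, hH⟩ := exists_circleTransform_eq_dslope
    ((hf x₁).2.comp_add_div hσ y₁) (M := M) fun x => by
      simpa using hM x₁ (y₁ + x / σ)
  have hσc : (σ : ℂ) ≠ 0 := by exact_mod_cast hσ.ne'
  have hquot : ∀ y : ℝ, y₁ ≠ y →
      (σ : ℂ) * circleTransform φ ((σ * y + -(σ * y₁) : ℝ) : ℂ) =
        (f x₁ y₁ - f x₁ y) / ((y₁ : ℂ) - y) := fun y hy => by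
    have hyc : (y₁ : ℂ) - y ≠ 0 := sub_ne_zero.2 (by exact_mod_cast hy)
    have hz : ((σ * y + -(σ * y₁) : ℝ) : ℂ) = -(σ * (y₁ - y)) := by push_cast; ring
    have harg : (y₁ : ℂ) + -(σ * (y₁ - y)) / σ = y := by field_simp; ring
    rw [hH, hz, dslope_of_ne _ (neg_ne_zero.2 (mul_ne_zero hσc hyc)), slope, vsub_eq_sub,
      harg, zero_div, add_zero, sub_zero, smul_eq_mul]
    field_simp
    ring
  have hcoef : ∀ n : ℤ, (σ : ℂ) * (f x₁ y₁ - f x₁ ((2 * Real.pi * n / σ : ℝ) : ℂ)) /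
      ((σ * y₁ - 2 * Real.pi * n : ℝ) : ℂ) =
      σ * circleTransform φ ((2 * Real.pi * n + -(σ * y₁) : ℝ) : ℂ) := fun n => by
    have hcancel : σ * (2 * Real.pi * n / σ) = 2 * Real.pi * n := mul_div_cancel₀ _ hσ.ne'
    have hne : y₁ ≠ 2 * Real.pi * n / σ := fun h => hy₁ n (by rw [h, hcancel])
    have h := hquot _ hne
    rw [hcancel] at h
    rw [h, ← hcancel, ← mul_sub, Complex.ofReal_mul, mul_div_mul_left _ _ hσc, Complex.ofReal_sub,
      hcancel]
  have hseries : HasSum (fun n : ℤ =>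
      ((σ : ℂ) * (f (x₁ : ℂ) (y₁ : ℂ) - f (x₁ : ℂ) ((2 * Real.pi * n / σ : ℝ) : ℂ)) /
          ((σ * y₁ - 2 * Real.pi * n : ℝ) : ℂ)) * sincFac σ n y₂)
      ((f (x₁ : ℂ) (y₁ : ℂ) - f (x₁ : ℂ) (y₂ : ℂ)) / ((y₁ : ℂ) - (y₂ : ℂ))) := by
    have h := (hasSum_circleTransform_mul_sincFac hφ (-(σ * y₁)) σ y₂).mul_left (σ : ℂ)
    rw [hquot y₂ hy] at h
    simp only [hcoef]
    simpa only [mul_assoc] using h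
  refine ⟨hseries.summable.norm, hseries,
    ⟨σ ^ 2 * ∫ x, ‖φ x‖ ^ 2 ∂AddCircle.haarAddCircle, ?_, ?_⟩, hasSum_sq_norm_sincFac σ y₂⟩
  · have h := (hasSum_sq_norm_circleTransform hφ (-(σ * y₁))).mul_left (σ ^ 2)
    have hterm : ∀ n : ℤ, σ ^ 2 * ‖f x₁ y₁ - f x₁ ((2 * Real.pi * n / σ : ℝ) : ℂ)‖ ^ 2 /
        (σ * y₁ - 2 * Real.pi * n) ^ 2 =
        σ ^ 2 * ‖circleTransform φ ((2 * Real.pi * n + -(σ * y₁) : ℝ) : ℂ)‖ ^ 2 := fun n => by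
      have hn := congrArg norm (hcoef n)
      simp only [norm_mul, norm_div, Complex.norm_real, Real.norm_eq_abs] at hn
      rw [← sq_abs σ, ← sq_abs (σ * y₁ - 2 * Real.pi * n), ← mul_pow, ← mul_pow, ← div_pow, hn]
    simp only [hterm]
    exact h
  · have hpi : 1 ≤ 4 / Real.pi := (one_le_div Real.pi_pos).2 Real.pi_le_four
    calc σ ^ 2 * ∫ x, ‖φ x‖ ^ 2 ∂AddCircle.haarAddCircle ≤ 1 * σ ^ 2 * M ^ 2 := by
          rw [one_mul]; gcongr
      _ ≤ 4 / Real.pi * σ ^ 2 * M ^ 2 := by gcongr
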